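/- If an implicative algebra is ∃-distributive, then every SK family is U-SK, and every fSK family is U-fSK. -/

import Mathlib

structure ImpStr (α : Type) [CompleteLattice α] where
  imp : α → α → α
  imp_mono : ∀ {a a' b b' : α}, a' ≤ a → b ≤ b' → imp a b ≤ imp a' b'
  imp_iInf : ∀ (a : α) (B : Set α), imp a (sInf B) = ⨅ b ∈ B, imp a b

namespace ImpStr

variable {α : Type} [CompleteLattice α] (S : ImpStr α)

/-- Application: `a · b := ⋀ {x | a ≤ b → x}`. -/
def app (a b : α) : α := sInf {x | a ≤ S.imp b x}

/-- Abstraction of a function `f : α → α`: `λ(f) := ⋀_{a} (a → f a)`. -/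
def lam (f : α → α) : α := ⨅ a : α, S.imp a (f a)

end ImpStr

structure ImpAlg (α : Type) [CompleteLattice α] extends ImpStr α where
  Sep : Set α
  sep_up : ∀ {a b : α}, a ∈ Sep → a ≤ b → b ∈ Sep
  sep_K : (⨅ a : α, ⨅ b : α, imp a (imp b a)) ∈ Sep
  sep_S : (⨅ a : α, ⨅ b : α, ⨅ c : α,
      imp (imp a (imp b c)) (imp (imp a b) (imp a c))) ∈ Sep
  sep_mp : ∀ {a b : α}, imp a b ∈ Sep → a ∈ Sep → b ∈ Sep

namespace ImpAlg

variable {α : Type} [CompleteLattice α] (A : ImpAlg α)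

/-- Entailment: `a ⊢_Σ b` iff `(a → b) ∈ Σ`. -/
def Ent (a b : α) : Prop := A.imp a b ∈ A.Sep

/-- `a ≡_Σ b` -/
def EquivS (a b : α) : Prop := A.Ent a b ∧ A.Ent b a

/-- The existential quantifier `∃_{i∈I} c_i := ⋀_x (⋀_i (c_i → x) → x)`. -/
def Eex {I : Type} (c : I → α) : α := ⨅ x : α, A.imp (⨅ i, A.imp (c i) x) x

/-- `a × b := ⋀_x ((a → b → x) → x)`. -/
def times (a b : α) : α := ⨅ x : α, A.imp (A.imp a (A.imp b x)) x

open Classical in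
/-- `δ_I(j,j')`. -/
noncomputable def delta {I : Type} (j j' : I) : α :=
  if j = j' then ⨅ x : α, A.imp (A.imp ⊤ x) x else A.imp ⊤ ⊥

/-- ×-disjoint family. -/
def TimesDisjoint {I : Type} (a : I → α) : Prop :=
  (⨅ i, ⨅ i', A.imp (A.times (a i) (a i')) (A.delta i i')) ∈ A.Sep

/-- ∧-disjoint family. -/
def WedgeDisjoint {I : Type} (a : I → α) : Prop :=
  (⨅ i, ⨅ i', A.imp (a i ⊓ a i') (A.delta i i')) ∈ A.Sep

/-- ×-functional two-indexed family. -/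
def TimesFunctional {I J : Type} (b : I → J → α) : Prop :=
  (⨅ i, ⨅ j, ⨅ j', A.imp (A.times (b i j) (b i j')) (A.delta j j')) ∈ A.Sep

/-- Supercompact element. -/
def Supercompact (a : α) : Prop :=
  ∀ {I : Type} (b : I → α), A.Ent a (A.Eex b) → ∃ i, A.Ent a (b i)

/-- Indecomposable element. -/
def Indecomposable (a : α) : Prop :=
  ∀ {I : Type} (b : I → α), A.TimesDisjoint b → A.Ent a (A.Eex b) → ∃ i, A.Ent a (b i)

/-- Supercompact (SK) family. -/
def SKFam {I : Type} (a : I → α) : Prop :=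
  ∀ (J : I → Type) (b : ∀ i, J i → α),
    (⨅ i, A.imp (a i) (A.Eex (b i))) ∈ A.Sep →
    ∃ f : ∀ i, J i, (⨅ i, A.imp (a i) (b i (f i))) ∈ A.Sep

/-- Uniformly supercompact (U-SK) family. -/
def USKFam {I : Type} (a : I → α) : Prop :=
  ∀ {K : Type} (f : K → I), A.SKFam (a ∘ f)

/-- Componentwise supercompact (cSK) family. -/
def cSKFam {I : Type} (a : I → α) : Prop := ∀ i, A.Supercompact (a i)

/-- Functionally supercompact (fSK) family. -/
def fSKFam {I : Type} (a : I → α) : Prop :=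
  ∀ {J : Type} (b : I → J → α), A.TimesFunctional b →
    (⨅ i, A.imp (a i) (A.Eex (b i))) ∈ A.Sep →
    ∃! f : I → J, (⨅ i, A.imp (a i) (b i (f i))) ∈ A.Sep

/-- Weakly functionally supercompact (wfSK) family. -/
def wfSKFam {I : Type} (a : I → α) : Prop :=
  ∀ {J : Type} (b : I → J → α), A.TimesFunctional b →
    (⨅ i, A.imp (a i) (A.Eex (b i))) ∈ A.Sep →
    ∃ f : I → J, (⨅ i, A.imp (a i) (b i (f i))) ∈ A.Sep

/-- Uniformly functionally supercompact (U-fSK) family. -/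
def UfSKFam {I : Type} (a : I → α) : Prop :=
  ∀ {K : Type} (f : K → I), A.fSKFam (a ∘ f)

/-- Uniformly weakly functionally supercompact (U-wfSK) family. -/
def UwfSKFam {I : Type} (a : I → α) : Prop :=
  ∀ {K : Type} (f : K → I), A.wfSKFam (a ∘ f)

/-- Componentwise indecomposable (cInd) family. -/
def cIndFam {I : Type} (a : I → α) : Prop := ∀ i, A.Indecomposable (a i)

end ImpAlg

/-- ∃-distributivity: the (class-indexed) infimum of all distributivity implications
lies in the separator. -/
def ImpAlg.ExDistrib {α : Type} [CompleteLattice α] (A : ImpAlg α) : Prop :=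
  (⨅ K : Type, ⨅ J : K → Type, ⨅ b : ∀ k, J k → α,
      A.imp (⨅ k, A.Eex (b k))
        (A.Eex (fun f : ∀ k, J k => ⨅ k, b k (f k)))) ∈ A.Sep

namespace ImpAlg

section helpers

variable {α : Type} [CompleteLattice α] (A : ImpAlg α)

/-- Uniform validity of a family. -/
def V {ι : Sort*} (φ : ι → α) : Prop := (⨅ i, φ i) ∈ A.Sep

variable {A}

theorem V.mono {ι κ : Sort*} {φ : ι → α} {ψ : κ → α} (h : A.V φ)
    (g : ∀ k, ∃ i, φ i ≤ ψ k) : A.V ψ :=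
  A.sep_up h (le_iInf fun k => by
    obtain ⟨i, hi⟩ := g k
    exact (iInf_le φ i).trans hi)

theorem V.re {ι κ : Sort*} {φ : ι → α} (h : A.V φ) (g : κ → ι) : A.V (fun k => φ (g k)) :=
  h.mono fun k => ⟨g k, le_rfl⟩

theorem imp_iInf' {κ : Sort*} (a : α) (f : κ → α) : A.imp a (⨅ k, f k) = ⨅ k, A.imp a (f k) := by
  have := A.imp_iInf a (Set.range f)
  rw [sInf_range] at this
  rw [this, iInf_range]

theorem V.mp {ι : Sort*} {φ ψ : ι → α} (h : A.V fun i => A.imp (φ i) (ψ i)) (h' : A.V φ) :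
    A.V ψ := by
  refine A.sep_mp (A.sep_up h ?_) h'
  rw [imp_iInf']
  exact iInf_mono fun i => A.imp_mono (iInf_le _ _) le_rfl

theorem vK {ι : Sort*} (a b : ι → α) : A.V fun i => A.imp (a i) (A.imp (b i) (a i)) :=
  A.sep_up A.sep_K (le_iInf fun i => (iInf_le _ (a i)).trans (iInf_le _ (b i)))

theorem vS {ι : Sort*} (a b c : ι → α) : A.V fun i =>
    A.imp (A.imp (a i) (A.imp (b i) (c i))) (A.imp (A.imp (a i) (b i)) (A.imp (a i) (c i))) :=
  A.sep_up A.sep_S (le_iInf fun i =>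
    ((iInf_le _ (a i)).trans (iInf_le _ (b i))).trans (iInf_le _ (c i)))

variable {ι : Sort*} {a b c d : ι → α}

theorem V.lift (a : ι → α) (h : A.V b) : A.V fun i => A.imp (a i) (b i) := (vK b a).mp h

theorem V.app (h : A.V fun i => A.imp (a i) (A.imp (b i) (c i)))
    (h' : A.V fun i => A.imp (a i) (b i)) : A.V fun i => A.imp (a i) (c i) :=
  ((vS a b c).mp h).mp h'

theorem V.comp (h : A.V fun i => A.imp (a i) (b i)) (h' : A.V fun i => A.imp (b i) (c i)) :
    A.V fun i => A.imp (a i) (c i) :=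
  V.app (h'.lift a) h

theorem vI (a : ι → α) : A.V fun i => A.imp (a i) (a i) :=
  V.app (vK a (fun i => A.imp (a i) (a i))) (vK a a)

theorem V.swap (h : A.V fun i => A.imp (a i) (A.imp (b i) (c i))) :
    A.V fun i => A.imp (b i) (A.imp (a i) (c i)) :=
  (vK b a).comp ((vS a b c).mp h)

theorem vC (a b c : ι → α) : A.V fun i =>
    A.imp (A.imp (a i) (A.imp (b i) (c i))) (A.imp (b i) (A.imp (a i) (c i))) :=
  ((vK b a).comp (vS a b c).swap).swap

theorem vle (h : ∀ i, a i ≤ b i) : A.V fun i => A.imp (a i) (b i) :=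
  (vI a).mono fun i => ⟨i, A.imp_mono le_rfl (h i)⟩

/-- compose under one implication -/
theorem V.comp2 (h : A.V fun i => A.imp (a i) (A.imp (b i) (c i)))
    (h' : A.V fun i => A.imp (c i) (d i)) : A.V fun i => A.imp (a i) (A.imp (b i) (d i)) :=
  h.comp ((vS b c d).mp (h'.lift b))

theorem V.times_elim (h : A.V fun i => A.imp (a i) (A.imp (b i) (c i))) :
    A.V fun i => A.imp (A.times (a i) (b i)) (c i) :=
  V.app (vle fun i => iInf_le _ (c i)) (h.lift _)

theorem times_intro (a b : ι → α) :
    A.V fun i => A.imp (a i) (A.imp (b i) (A.times (a i) (b i))) := by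
  have h : A.V fun p : PSigma (fun _ : ι => α) => A.imp (a p.1) (A.imp (b p.1)
      (A.imp (A.imp (a p.1) (A.imp (b p.1) p.2)) p.2)) :=
    (vI fun p : PSigma (fun _ : ι => α) => A.imp (a p.1) (A.imp (b p.1) p.2)).swap.comp (vC _ _ _)
  refine A.sep_up h (le_iInf fun i => ?_)
  simp only [times, imp_iInf']
  exact le_iInf fun x => iInf_le _ (⟨i, x⟩ : PSigma (fun _ : ι => α))

theorem V.ex_elim {J : ι → Type} {c : ∀ i, J i → α} {y : ι → α}
    (h : A.V fun p : PSigma J => A.imp (c p.1 p.2) (y p.1)) :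
    A.V fun i => A.imp (A.Eex (c i)) (y i) := by
  have h' : A.V fun i => ⨅ j, A.imp (c i j) (y i) :=
    A.sep_up h (le_iInf fun i => le_iInf fun j => iInf_le _ (⟨i, j⟩ : PSigma J))
  exact V.app (vle fun i => iInf_le _ (y i)) (h'.lift _)

theorem ex_intro {J : ι → Type} (c : ∀ i, J i → α) (j : ∀ i, J i) :
    A.V fun i => A.imp (c i (j i)) (A.Eex (c i)) := by
  have h : A.V fun p : PSigma (fun _ : ι => α) => A.imp (c p.1 (j p.1))
      (A.imp (⨅ j, A.imp (c p.1 j) p.2) p.2) :=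
    V.swap (vle fun p => iInf_le _ (j p.1))
  refine A.sep_up h (le_iInf fun i => ?_)
  simp only [Eex, imp_iInf']
  exact le_iInf fun x => iInf_le _ (⟨i, x⟩ : PSigma (fun _ : ι => α))

variable (A) in
/-- The truth value of a proposition. -/
def br (P : Prop) : α := A.Eex (fun _ : PLift P => (⊤ : α))

theorem br_true {P : ι → Prop} (h : ∀ i, P i) : A.V fun i => A.br (P i) := by
  have h1 : A.V fun i => A.imp (⊤ : α) (A.br (P i)) :=
    ex_intro (J := fun i => PLift (P i)) (fun _ _ => ⊤) (fun i => ⟨h i⟩)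
  refine h1.mp ?_
  refine (vI (fun _ : ι => (⊤ : α))).mono fun i => ⟨i, le_top⟩

theorem V.br_elim {P : ι → Prop} {y : ι → α}
    (h : A.V fun p : PSigma (fun i => PLift (P i)) => y p.1) :
    A.V fun i => A.imp (A.br (P i)) (y i) :=
  V.ex_elim (J := fun i => PLift (P i)) (c := fun _ _ => ⊤) (h.lift _)

theorem br_false {P : Prop} (h : ¬ P) : A.br P = A.imp ⊤ ⊥ := by
  have : IsEmpty (PLift P) := ⟨fun p => h p.down⟩
  simp only [br, Eex, iInf_of_empty]
  rw [← imp_iInf']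
  exact congrArg _ (le_antisymm (iInf_le _ ⊥) bot_le)

theorem delta_eq {I : Type} (j j' : I) : A.delta j j' = A.br (j = j') := by
  by_cases h : j = j'
  · have : Nonempty (PLift (j = j')) := ⟨⟨h⟩⟩
    simp only [delta, if_pos h, br, Eex, iInf_const]
  · rw [br_false h, delta, if_neg h]

theorem V.distr (hd : A.ExDistrib) (K : ι → Type) (J : ∀ i, K i → Type)
    (b : ∀ i k, J i k → α) : A.V fun i => A.imp (⨅ k, A.Eex (b i k))
        (A.Eex (fun f : ∀ k, J i k => ⨅ k, b i k (f k))) :=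
  A.sep_up hd (le_iInf fun i => ((iInf_le _ (K i)).trans (iInf_le _ (J i))).trans (iInf_le _ (b i)))

/-- Collecting a reindexed cover over fibres. -/
theorem fibre_cover (hd : A.ExDistrib) {I K : Type} {a : I → α} (f : K → I) (J : K → Type)
    (b : ∀ k, J k → α) (h : (⨅ k, A.imp (a (f k)) (A.Eex (b k))) ∈ A.Sep) :
    A.V fun i => A.imp (a i)
      (A.Eex (fun g : ∀ k : {k // f k = i}, J k.1 => ⨅ k, b k.1 (g k))) := by
  refine V.comp (b := fun i => ⨅ k : {k // f k = i}, A.Eex (b k.1)) ?_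
    (V.distr hd (fun i => {k // f k = i}) (fun _ k => J k.1) (fun _ k => b k.1))
  refine A.sep_up h (le_iInf fun i => ?_)
  dsimp only
  rw [imp_iInf']
  refine le_iInf ?_
  rintro ⟨k, rfl⟩
  exact iInf_le _ k

theorem fibre_uncover {I K : Type} {a : I → α} (f : K → I) (J : K → Type)
    (b : ∀ k, J k → α) (g : ∀ i, ∀ k : {k // f k = i}, J k.1)
    (h : A.V fun i => A.imp (a i) (⨅ k : {k // f k = i}, b k.1 (g i k))) :
    (⨅ k, A.imp (a (f k)) (b k (g (f k) ⟨k, rfl⟩))) ∈ A.Sep :=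
  A.sep_up h (le_iInf fun k => (iInf_le _ (f k)).trans
    (A.imp_mono le_rfl (iInf_le (fun k' : {k' // f k' = f k} => b k'.1 (g (f k) k')) ⟨k, rfl⟩)))

theorem fSK_not_bot (hd : A.ExDistrib) {I : Type} {a : I → α} (ha : A.fSKFam a) (i₀ : I)
    (h : A.imp (a i₀) (A.imp ⊤ ⊥) ∈ A.Sep) : False := by
  classical
  have h1 : A.V fun i => A.imp (a i) (A.br (i ≠ i₀)) := by
    have h0 : A.V fun i => A.imp (a i) (⨅ _ : PLift (i = i₀), A.br False) := by
      refine A.sep_up h (le_iInf fun i => ?_)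
      dsimp only
      rw [imp_iInf']
      refine le_iInf ?_
      rintro ⟨rfl⟩
      rw [br_false not_false]
    refine h0.comp ((V.distr hd (fun i => PLift (i = i₀)) (fun _ _ => PLift False)
      (fun _ _ _ => ⊤)).comp ?_)
    refine V.ex_elim (V.lift _ (br_true ?_))
    rintro ⟨i, g⟩ hi
    exact (g ⟨hi⟩).down
  have hf : A.TimesFunctional (fun (i : I) (j : Bool) => A.br (i ≠ i₀ ∧ j = true)) := by
    have : A.V fun p : I × Bool × Bool =>
        A.imp (A.times (A.br (p.1 ≠ i₀ ∧ p.2.1 = true)) (A.br (p.1 ≠ i₀ ∧ p.2.2 = true)))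
          (A.br (p.2.1 = p.2.2)) := by
      refine V.times_elim (V.br_elim (V.br_elim (br_true ?_)))
      rintro ⟨⟨⟨i, j, j'⟩, p⟩, q⟩
      exact p.down.2.trans q.down.2.symm
    refine A.sep_up this (le_iInf fun i => le_iInf fun j => le_iInf fun j' => ?_)
    rw [delta_eq]
    exact iInf_le _ (i, j, j')
  have h2 : A.V fun i => A.imp (A.br (i ≠ i₀)) (A.br (i ≠ i₀ ∧ true = true)) :=
    V.br_elim (br_true fun p => ⟨p.2.down, rfl⟩)
  have he : (⨅ i, A.imp (a i) (A.Eex fun j : Bool => A.br (i ≠ i₀ ∧ j = true))) ∈ A.Sep :=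
    (h1.comp h2).comp (ex_intro (J := fun _ => Bool)
      (fun i j => A.br (i ≠ i₀ ∧ j = true)) (fun _ => true))
  obtain ⟨s, -, hs⟩ := ha _ hf he
  have e1 := hs (fun _ => true) (h1.comp h2)
  have e2 := hs (fun i => if i = i₀ then false else true) (by
    have : A.V fun i => A.imp (a i) (A.br (i ≠ i₀ ∧ (if i = i₀ then false else true) = true)) := by
      refine h1.comp (V.br_elim (br_true ?_))
      rintro ⟨i, hi⟩
      exact ⟨hi.down, if_neg hi.down⟩
    exact this)
  have := congrFun (e1.trans e2.symm) i₀
  simp at this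

end helpers

end ImpAlg

open ImpAlg in
theorem stmt16_fSK {α : Type} [CompleteLattice α] (A : ImpAlg α)
    (hd : A.ExDistrib) {I : Type} (a : I → α) (ha : A.fSKFam a) : A.UfSKFam a := by
  intro K f J b hb hab
  -- functionality, uncurried
  have hb' : A.V fun p : K × J × J =>
      A.imp (b p.1 p.2.1) (A.imp (b p.1 p.2.2) (A.br (p.2.1 = p.2.2))) := by
    refine (times_intro _ _).comp2 ?_
    refine A.sep_up hb (le_iInf fun p => ?_)
    dsimp only
    rw [← delta_eq]
    exact ((iInf_le _ p.1).trans (iInf_le _ p.2.1)).trans (iInf_le _ p.2.2)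
  let F : I → Type := fun i => {k // f k = i} → J
  let c : ∀ i, F i → α := fun i g => ⨅ k, b k.1 (g k)
  let b' : I → (Σ i, F i) → α := fun i s => A.Eex fun p : {g : F i // (⟨i, g⟩ : Σ i, F i) = s} =>
    c i p.1
  have hcov : A.V fun i => A.imp (a i) (A.Eex (c i)) := fibre_cover hd f (fun _ => J) b hab
  have hex : A.V fun i => A.imp (a i) (A.Eex (b' i)) := by
    refine hcov.comp (V.ex_elim ?_)
    refine V.comp (b := fun p : PSigma F => b' p.1 ⟨p.1, p.2⟩) ?_ ?_
    · exact ex_intro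
        (J := fun p : PSigma F => {g : F p.1 // (⟨p.1, g⟩ : Σ i, F i) = ⟨p.1, p.2⟩})
        (fun p q => c p.1 q.1) (fun p => ⟨p.2, rfl⟩)
    · exact ex_intro (J := fun _ : PSigma F => Σ i, F i) (fun p s => b' p.1 s)
        (fun p => ⟨p.1, p.2⟩)
  have hdel : A.V fun p : Σ i, F i × F i =>
      A.imp (c p.1 p.2.1) (A.imp (c p.1 p.2.2) (A.br (p.2.1 = p.2.2))) := by
    have h0 : A.V fun p : Σ i, F i × F i =>
        A.imp (c p.1 p.2.1) (A.imp (c p.1 p.2.2) (⨅ k, A.br (p.2.1 k = p.2.2 k))) := by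
      refine A.sep_up hb' (le_iInf fun p => ?_)
      simp only [imp_iInf']
      refine le_iInf fun k => (iInf_le _ (k.1, p.2.1 k, p.2.2 k)).trans ?_
      exact A.imp_mono (iInf_le _ k) (A.imp_mono (iInf_le _ k) le_rfl)
    refine h0.comp2 ((V.distr hd (fun p : Σ i, F i × F i => {k // f k = p.1})
      (fun p k => PLift (p.2.1 k = p.2.2 k)) (fun _ _ _ => ⊤)).comp ?_)
    refine V.ex_elim (V.lift _ (br_true ?_))
    rintro ⟨p, g⟩
    exact funext fun k => (g k).down
  have hfun : A.TimesFunctional b' := by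
    have : A.V fun p : I × (Σ i, F i) × (Σ i, F i) =>
        A.imp (A.times (b' p.1 p.2.1) (b' p.1 p.2.2)) (A.br (p.2.1 = p.2.2)) := by
      refine V.times_elim (V.ex_elim (V.swap (V.ex_elim (V.swap ?_))))
      refine hdel.mono ?_
      rintro ⟨⟨⟨i, s, s'⟩, ⟨g, hg⟩⟩, ⟨g', hg'⟩⟩
      have hg1 : (⟨i, g⟩ : Σ i, F i) = s := hg
      have hg2 : (⟨i, g'⟩ : Σ i, F i) = s' := hg'
      have this : (g = g') = (s = s') := by
        rw [← hg1, ← hg2]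
        simp
      exact ⟨⟨i, g, g'⟩, A.imp_mono le_rfl (A.imp_mono le_rfl (le_of_eq (congrArg A.br this)))⟩
    refine A.sep_up this (le_iInf fun i => le_iInf fun j => le_iInf fun j' => ?_)
    rw [delta_eq]
    exact iInf_le _ (i, j, j')
  obtain ⟨s, hs, -⟩ := ha b' hfun hex
  have hg : ∀ i, ∃ g : F i, (⟨i, g⟩ : Σ i, F i) = s i := by
    intro i
    by_contra hcon
    refine fSK_not_bot hd ha i ?_
    have h1 : A.imp (a i) (b' i (s i)) ∈ A.Sep := A.sep_up hs (iInf_le _ i)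
    have : IsEmpty {g : F i // (⟨i, g⟩ : Σ i, F i) = s i} := ⟨fun p => hcon ⟨p.1, p.2⟩⟩
    have h2 : b' i (s i) ≤ A.imp ⊤ ⊥ := by
      refine (iInf_le _ (⊥ : α)).trans ?_
      rw [iInf_of_empty]
    exact A.sep_up h1 (A.imp_mono le_rfl h2)
  choose g hg using hg
  have hfin : A.V fun i => A.imp (a i) (c i (g i)) := by
    refine V.comp (b := fun i => b' i (s i)) hs (V.ex_elim (vle ?_))
    rintro ⟨i, g', hg'⟩
    have : g' = g i := by
      have := hg'.trans (hg i).symm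
      simpa using this
    subst this
    exact le_rfl
  refine ⟨fun k => g (f k) ⟨k, rfl⟩, fibre_uncover f (fun _ => J) b g hfin, ?_⟩
  have hl := fibre_uncover f (fun _ => J) b g hfin
  intro h' hh'
  funext k
  by_contra hne
  refine fSK_not_bot hd ha (f k) ?_
  have h1 : A.V fun _ : Unit => A.imp (a (f k)) (b k (h' k)) :=
    V.mono (A := A) (φ := fun k => A.imp (a (f k)) (b k (h' k))) hh' fun _ => ⟨k, le_rfl⟩
  have h2 : A.V fun _ : Unit => A.imp (a (f k)) (b k (g (f k) ⟨k, rfl⟩)) :=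
    V.mono (A := A) (φ := fun k => A.imp (a (f k)) (b k (g (f k) ⟨k, rfl⟩))) hl
      fun _ => ⟨k, le_rfl⟩
  have h3 := hb'.re (fun _ : Unit => (k, h' k, g (f k) ⟨k, rfl⟩))
  have h4 := V.app (h1.comp h3) h2
  simp only [V, iInf_const] at h4
  rwa [br_false hne] at h4

open ImpAlg in
theorem stmt16_SK {α : Type} [CompleteLattice α] (A : ImpAlg α)
    (hd : A.ExDistrib) {I : Type} (a : I → α) (ha : A.SKFam a) : A.USKFam a := by
  intro K f J b hab
  let F : I → Type := fun i => ∀ k : {k // f k = i}, J k.1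
  let c : ∀ i, F i → α := fun i g => ⨅ k : {k // f k = i}, b k.1 (g k)
  have hc : (⨅ i, A.imp (a i) (A.Eex (c i))) ∈ A.Sep := fibre_cover hd f J b hab
  have h : ∃ g : ∀ i, F i, (⨅ i, A.imp (a i) (c i (g i))) ∈ A.Sep := ha F c hc
  obtain ⟨g, hg⟩ := h
  have h2 := fibre_uncover f J b g hg
  exact ⟨fun k => g (f k) ⟨k, rfl⟩, h2⟩

/-- if an implicative algebra is ∃-distributive, then every SK family
is U-SK and every fSK family is U-fSK. -/
theorem stmt16 {α : Type} [CompleteLattice α] (A : ImpAlg α)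
    (hd : A.ExDistrib) :
    (∀ {I : Type} (a : I → α), A.SKFam a → A.USKFam a) ∧
      (∀ {I : Type} (a : I → α), A.fSKFam a → A.UfSKFam a) :=
  ⟨fun a ha => stmt16_SK A hd a ha, fun a ha => stmt16_fSK A hd a ha⟩
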